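/- Let φ be a flow on a generalized Peano continuum M and let U be a nonempty, compact, connected, positively invariant subset of M such that every compact minimal set contained in U is hyper-stable. If (xₙ) is a sequence in U converging to x, then d_H(ω(xₙ), ω(x)) → 0. -/

import Mathlib

open Set Filter Topology Metric TopologicalSpace

variable {M : Type*} [MetricSpace M]

/-- A set is invariant under the flow `φ`. -/
def IsFlowInvariant (φ : ℝ → M → M) (K : Set M) : Prop :=
  ∀ x ∈ K, ∀ t : ℝ, φ t x ∈ K

/-- A set is positively invariant under the flow `φ`. -/
def IsPosInvariant (φ : ℝ → M → M) (K : Set M) : Prop :=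
  ∀ x ∈ K, ∀ t : ℝ, 0 ≤ t → φ t x ∈ K

/-- A compact minimal set: nonempty, compact, invariant, with no nonempty proper
closed invariant subset. -/
def IsCompactMinimalSet (φ : ℝ → M → M) (K : Set M) : Prop :=
  K.Nonempty ∧ IsCompact K ∧ IsFlowInvariant φ K ∧
    ∀ K' ⊆ K, K'.Nonempty → IsClosed K' → IsFlowInvariant φ K' → K' = K

/-- Lyapunov stability: every neighborhood of `K` contains a positively invariant
neighborhood of `K`. -/
def IsLyapunovStable (φ : ℝ → M → M) (K : Set M) : Prop :=
  ∀ U ∈ 𝓝ˢ K, ∃ V ∈ 𝓝ˢ K, V ⊆ U ∧ IsPosInvariant φ V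

/-- The ω-limit set of a point. -/
def omegaLimitSet (φ : ℝ → M → M) (x : M) : Set M :=
  ⋂ T ∈ Ici (0 : ℝ), closure ((fun t => φ t x) '' Ici T)

/-- The α-limit set of a point. -/
def alphaLimitSet (φ : ℝ → M → M) (x : M) : Set M :=
  ⋂ T ∈ Iic (0 : ℝ), closure ((fun t => φ t x) '' Iic T)

/-- A compact minimal set is hyper-stable if some neighborhood of it in `M` meets no
Lyapunov unstable compact minimal set. -/
def IsHyperStable (φ : ℝ → M → M) (Λ : Set M) : Prop :=
  IsCompactMinimalSet φ Λ ∧ ∃ W ∈ 𝓝ˢ Λ, ∀ Γ : Set M,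
    IsCompactMinimalSet φ Γ → ¬ IsLyapunovStable φ Γ → Γ ∩ W = ∅

theorem mem_omegaLimitSet_iff {φ : ℝ → M → M} {y z : M} :
    z ∈ omegaLimitSet φ y ↔ MapClusterPt z atTop (fun t => φ t y) := by
  simp only [omegaLimitSet, mem_iInter, mem_Ici, mem_closure_iff_nhds, mapClusterPt_iff_frequently,
    frequently_atTop]
  constructor
  · intro h s hs a
    obtain ⟨_, hw, t, ht, rfl⟩ := h (max a 0) (le_max_right _ _) s hs
    exact ⟨t, (le_max_left _ _).trans ht, hw⟩
  · intro h T _ s hs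
    obtain ⟨t, ht, hw⟩ := h s hs T
    exact ⟨_, hw, t, ht, rfl⟩

theorem isClosed_omegaLimitSet (φ : ℝ → M → M) (y : M) : IsClosed (omegaLimitSet φ y) :=
  isClosed_biInter fun _ _ => isClosed_closure

theorem isFlowInvariant_omegaLimitSet {φ : ℝ → M → M}
    (hφcont : Continuous fun p : ℝ × M => φ p.1 p.2)
    (hφadd : ∀ s t : ℝ, ∀ x : M, φ s (φ t x) = φ (s + t) x) (y : M) :
    IsFlowInvariant φ (omegaLimitSet φ y) := by
  intro z hz s
  rw [mem_omegaLimitSet_iff] at hz ⊢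
  have hs : Continuous (φ s) := hφcont.comp (by fun_prop : Continuous fun z : M => (s, z))
  have h := hz.continuousAt_comp hs.continuousAt
  have heq : φ s ∘ (fun t => φ t y) = (fun t => φ t y) ∘ fun t => s + t := by
    ext t
    exact hφadd s t y
  rw [heq] at h
  exact h.of_comp (tendsto_atTop_add_const_left _ s tendsto_id)

theorem omegaLimitSet_subset_of_mem {φ : ℝ → M → M}
    (hφadd : ∀ s t : ℝ, ∀ x : M, φ s (φ t x) = φ (s + t) x) {V C : Set M}
    (hV : IsPosInvariant φ V) (hVC : V ⊆ C) (hC : IsClosed C) {y : M} {t : ℝ} (ht : φ t y ∈ V) :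
    omegaLimitSet φ y ⊆ C := by
  intro z hz
  rw [mem_omegaLimitSet_iff] at hz
  refine hC.closure_subset (mem_closure_iff_clusterPt.2 (ClusterPt.mono hz ?_))
  refine tendsto_principal.2 ((eventually_ge_atTop t).mono fun r hr => hVC ?_)
  have h := hV _ ht (r - t) (sub_nonneg.2 hr)
  rwa [hφadd, sub_add_cancel] at h

/-- Every nonempty compact invariant set contains a compact minimal set. -/
theorem exists_isCompactMinimalSet_subset {φ : ℝ → M → M} {K : Set M} (hne : K.Nonempty)
    (hK : IsCompact K) (hinv : IsFlowInvariant φ K) :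
    ∃ Γ ⊆ K, IsCompactMinimalSet φ Γ := by
  obtain ⟨Γ, hΓK, hΓ⟩ := zorn_superset_nonempty
    {A : Set M | A ⊆ K ∧ A.Nonempty ∧ IsClosed A ∧ IsFlowInvariant φ A} (by
      intro c hc hchain hcne
      have hcK : ⋂₀ c ⊆ K := by
        obtain ⟨A, hA⟩ := hcne
        exact (sInter_subset_of_mem hA).trans (hc hA).1
      refine ⟨⋂₀ c, ⟨hcK, ?_, isClosed_sInter fun A hA => (hc hA).2.2.1, ?_⟩,
        fun A hA => sInter_subset_of_mem hA⟩
      · exact IsCompact.nonempty_sInter_of_directed_nonempty_isCompact_isClosed (hS := hcne.to_subtype)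
          (fun A hA B hB => (hchain.total hA hB).elim (fun h => ⟨A, hA, Subset.rfl, h⟩)
            fun h => ⟨B, hB, h, Subset.rfl⟩)
          (fun A hA => (hc hA).2.1)
          (fun A hA => hK.of_isClosed_subset (hc hA).2.2.1 (hc hA).1) fun A hA => (hc hA).2.2.1
      · intro z hz t A hA
        exact (hc hA).2.2.2 z (hz A hA) t)
    K ⟨Subset.rfl, hne, hK.isClosed, hinv⟩
  obtain ⟨⟨_, hΓne, hΓcl, hΓinv⟩, hmin⟩ := hΓ
  exact ⟨Γ, hΓK, hΓne, hK.of_isClosed_subset hΓcl hΓK, hΓinv, fun K' hK' hne' hcl' hinv' =>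
    hK'.antisymm (hmin ⟨hK'.trans hΓK, hne', hcl', hinv'⟩ hK')⟩

theorem IsHyperStable.isLyapunovStable {φ : ℝ → M → M} {Λ : Set M} (h : IsHyperStable φ Λ) :
    IsLyapunovStable φ Λ := by
  obtain ⟨hmin, W, hW, hdis⟩ := h
  by_contra hns
  obtain ⟨z, hz⟩ := hmin.1
  exact (hdis Λ hmin hns).subset ⟨hz, subset_of_mem_nhdsSet hW hz⟩

/-- A compact Lyapunov stable set which meets an ω-limit set contains it. -/
theorem IsLyapunovStable.omegaLimitSet_subset {φ : ℝ → M → M}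
    (hφadd : ∀ s t : ℝ, ∀ x : M, φ s (φ t x) = φ (s + t) x) {K : Set M}
    (hst : IsLyapunovStable φ K) (hK : IsCompact K) {y z : M} (hzK : z ∈ K)
    (hz : z ∈ omegaLimitSet φ y) : omegaLimitSet φ y ⊆ K := by
  rw [← hK.isClosed.closure_eq, closure_eq_iInter_cthickening]
  refine subset_iInter₂ fun δ hδ => ?_
  obtain ⟨V, hVn, hVsub, hV⟩ := hst _ (cthickening_mem_nhdsSet K hδ)
  rw [mem_omegaLimitSet_iff] at hz
  obtain ⟨t, ht⟩ := (hz.frequently (mem_nhdsSet_iff_forall.1 hVn z hzK)).exists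
  exact omegaLimitSet_subset_of_mem hφadd hV hVsub isClosed_cthickening ht

theorem omegaLimitSet_nonempty {φ : ℝ → M → M} {U : Set M} (hU : IsCompact U)
    (hUpos : IsPosInvariant φ U) {y : M} (hy : y ∈ U) : (omegaLimitSet φ y).Nonempty := by
  obtain ⟨z, -, hz⟩ := hU.exists_mapClusterPt (u := fun t => φ t y)
    (tendsto_principal.2 ((eventually_ge_atTop 0).mono fun t ht => hUpos y hy t ht))
  exact ⟨z, mem_omegaLimitSet_iff.2 hz⟩

theorem omegaLimitSet_subset {φ : ℝ → M → M} {U : Set M} (hU : IsClosed U)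
    (hUpos : IsPosInvariant φ U) {y : M} (hy : y ∈ U) : omegaLimitSet φ y ⊆ U :=
  (biInter_subset_of_mem (mem_Ici.2 le_rfl)).trans
    (closure_minimal (image_subset_iff.2 fun t ht => hUpos y hy t ht) hU)

/-- If every compact minimal set in the compact positively invariant set `U` is Lyapunov stable,
then the ω-limit sets of points of `U` are minimal. -/
theorem isCompactMinimalSet_omegaLimitSet {φ : ℝ → M → M}
    (hφcont : Continuous fun p : ℝ × M => φ p.1 p.2)
    (hφadd : ∀ s t : ℝ, ∀ x : M, φ s (φ t x) = φ (s + t) x)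
    {U : Set M} (hU : IsCompact U) (hUpos : IsPosInvariant φ U)
    (hst : ∀ Γ ⊆ U, IsCompactMinimalSet φ Γ → IsLyapunovStable φ Γ) {y : M} (hy : y ∈ U) :
    IsCompactMinimalSet φ (omegaLimitSet φ y) := by
  have hsub := omegaLimitSet_subset hU.isClosed hUpos hy
  obtain ⟨Γ, hΓ, hmin⟩ := exists_isCompactMinimalSet_subset (omegaLimitSet_nonempty hU hUpos hy)
    (hU.of_isClosed_subset (isClosed_omegaLimitSet φ y) hsub)
    (isFlowInvariant_omegaLimitSet hφcont hφadd y)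
  obtain ⟨z, hz⟩ := hmin.1
  rwa [((hst Γ (hΓ.trans hsub) hmin).omegaLimitSet_subset hφadd hmin.2.1 hz (hΓ hz)).antisymm hΓ]

/-- Every point close to a compact minimal set has an orbit visiting a given neighborhood of a
given point of that set. -/
theorem IsCompactMinimalSet.exists_mem_ball_mem_nhdsSet {φ : ℝ → M → M}
    (hφcont : Continuous fun p : ℝ × M => φ p.1 p.2) (hφzero : ∀ x : M, φ 0 x = x)
    (hφadd : ∀ s t : ℝ, ∀ x : M, φ s (φ t x) = φ (s + t) x) {Λ : Set M}
    (hΛ : IsCompactMinimalSet φ Λ) {p : M} (hp : p ∈ Λ) {ε : ℝ} (hε : 0 < ε) :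
    {z | ∃ t, φ t z ∈ ball p ε} ∈ 𝓝ˢ Λ := by
  have hcont : ∀ t, Continuous (φ t) := fun t =>
    hφcont.comp (by fun_prop : Continuous fun z : M => (t, z))
  have hopen : IsOpen {z | ∃ t, φ t z ∈ ball p ε} := by
    simp only [ofPred_exists]
    exact isOpen_iUnion fun t => isOpen_ball.preimage (hcont t)
  refine hopen.mem_nhdsSet.2 fun z hz => ?_
  by_contra hno
  have hne : (Λ ∩ {z | ∃ t, φ t z ∈ ball p ε}ᶜ) = Λ := by
    refine hΛ.2.2.2 _ inter_subset_left ⟨z, hz, hno⟩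
      (hΛ.2.1.isClosed.inter hopen.isClosed_compl) ?_
    rintro w ⟨hw, hw'⟩ s
    refine ⟨hΛ.2.2.1 w hw s, fun ⟨t, ht⟩ => hw' ⟨t + s, ?_⟩⟩
    rwa [← hφadd]
  exact (hne.ge hp).2 ⟨0, by simpa [hφzero] using hε⟩

theorem omegaLimit_hausdorff_continuous_in_U [LocallyCompactSpace M] [ConnectedSpace M] [LocallyConnectedSpace M]
    (φ : ℝ → M → M)
    (hφcont : Continuous fun p : ℝ × M => φ p.1 p.2)
    (hφzero : ∀ x : M, φ 0 x = x)
    (hφadd : ∀ s t : ℝ, ∀ x : M, φ s (φ t x) = φ (s + t) x)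
    (U : Set M) (hUne : U.Nonempty) (hUcomp : IsCompact U) (hUconn : IsConnected U)
    (hUpos : IsPosInvariant φ U)
    (hmin : ∀ Γ : Set M, Γ ⊆ U → IsCompactMinimalSet φ Γ → IsHyperStable φ Γ)
    (x : M) (xs : ℕ → M) (hxs : ∀ n, xs n ∈ U) (hlim : Filter.Tendsto xs Filter.atTop (𝓝 x)) :
    Filter.Tendsto (fun n => hausdorffDist (omegaLimitSet φ (xs n)) (omegaLimitSet φ x))
      Filter.atTop (𝓝 0) := by
  have hst : ∀ Γ ⊆ U, IsCompactMinimalSet φ Γ → IsLyapunovStable φ Γ := fun Γ hΓ h =>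
    (hmin Γ hΓ h).isLyapunovStable
  have hx : x ∈ U := hUcomp.isClosed.mem_of_tendsto hlim (Eventually.of_forall hxs)
  have hΛ := isCompactMinimalSet_omegaLimitSet hφcont hφadd hUcomp hUpos hst hx
  have hΛst := hst _ (omegaLimitSet_subset hUcomp.isClosed hUpos hx) hΛ
  set Λ := omegaLimitSet φ x with hΛdef
  have hupper : ∀ W ∈ 𝓝ˢ Λ, ∀ᶠ n in atTop, omegaLimitSet φ (xs n) ⊆ W := by
    intro W hW
    obtain ⟨O, hO, hΛO, hOW⟩ := mem_nhdsSet_iff_exists.1 hW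
    obtain ⟨δ, hδ, hδO⟩ := hΛ.2.1.exists_cthickening_subset_open hO hΛO
    obtain ⟨V, hVn, hVsub, hV⟩ := hΛst _ (cthickening_mem_nhdsSet Λ hδ)
    obtain ⟨z, hz⟩ := hΛ.1
    have hzV : interior V ∈ 𝓝 z := interior_mem_nhds.2 (mem_nhdsSet_iff_forall.1 hVn z hz)
    obtain ⟨t, ht⟩ := ((mem_omegaLimitSet_iff.1 hz).frequently hzV).exists
    have hcont : Continuous (φ t) := hφcont.comp (by fun_prop : Continuous fun z : M => (t, z))
    filter_upwards [(hcont.tendsto x).comp hlim (isOpen_interior.mem_nhds ht)] with n hn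
    exact (omegaLimitSet_subset_of_mem hφadd hV hVsub isClosed_cthickening
      (interior_subset hn)).trans (hδO.trans hOW)
  rw [Metric.tendsto_nhds]
  intro ε hε
  obtain ⟨F, hFΛ, hF, hcov⟩ := hΛ.2.1.finite_cover_balls (show 0 < ε / 4 by positivity)
  have hvisit : ∀ᶠ n in atTop, ∀ p ∈ F,
      omegaLimitSet φ (xs n) ⊆ {z | ∃ t, φ t z ∈ ball p (ε / 4)} :=
    hF.eventually_all.2 fun p hp => hupper _
      (hΛ.exists_mem_ball_mem_nhdsSet hφcont hφzero hφadd (hFΛ hp) (by positivity))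
  filter_upwards [hvisit, hupper _ (thickening_mem_nhdsSet Λ (half_pos hε))] with n hn hnear
  rw [Real.dist_0_eq_abs, abs_of_nonneg hausdorffDist_nonneg]
  refine (hausdorffDist_le_of_mem_dist (half_pos hε).le (fun z hz => ?_) fun z hz => ?_).trans_lt
    (half_lt_self hε)
  · obtain ⟨w, hw, hzw⟩ := mem_thickening_iff.1 (hnear hz)
    exact ⟨w, hw, hzw.le⟩
  · obtain ⟨p, hp, hzp⟩ := mem_iUnion₂.1 (hcov hz)
    obtain ⟨w, hw⟩ := omegaLimitSet_nonempty hUcomp hUpos (hxs n)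
    obtain ⟨t, ht⟩ := hn p hp hw
    refine ⟨φ t w, isFlowInvariant_omegaLimitSet hφcont hφadd _ w hw t, ?_⟩
    have h := dist_triangle_right z (φ t w) p
    rw [mem_ball] at hzp ht
    linarith
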